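/- Let N and r be positive integers and i ∈ {0, 1, …, N−1}. Suppose K is a compact interval with non-empty interior contained in Λ = {x ∈ ℝ : lim_{j→∞} discr X_{jN+i}(x) exists and is negative}. Assume lim_{j→∞} a_{(j+1)N+i−1}/a_{jN+i−1} = 1 and that the sequence of matrix-valued functions (X_{jN+i} restricted to K : j ∈ ℕ) belongs to 𝒟_r(K, GL(2,ℝ)). Then inf_{n ≥ 0} a_n > 0. -/

import Mathlib

open Filter Topology

attribute [local instance] Matrix.normedAddCommGroup

noncomputable section

abbrev Mat2 := Matrix (Fin 2) (Fin 2) ℝ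

/-- The transfer matrix `B_n(x)` built from the Jacobi parameters `(a_n)`, `(b_n)`. -/
def Bmat (a b : ℕ → ℝ) (n : ℕ) (x : ℝ) : Mat2 :=
  !![0, 1; -(a (n - 1)) / a n, (x - b n) / a n]

/-- Product in decreasing index order: `prodD C n0 len = C (n0+len-1) ⋯ C n0`. -/
def prodD (C : ℕ → Mat2) (n0 : ℕ) : ℕ → Mat2
  | 0 => 1
  | (len + 1) => C (n0 + len) * prodD C n0 len

/-- `N`-step transfer matrix `X_n(x) = B_{n+N-1}(x) ⋯ B_n(x)`. -/
def Xmat (a b : ℕ → ℝ) (N n : ℕ) (x : ℝ) : Mat2 :=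
  prodD (fun j => Bmat a b j x) n N

/-- Discriminant of a `2×2` matrix. -/
def discr (M : Mat2) : ℝ := (Matrix.trace M) ^ 2 - 4 * M.det

/-- Iterated forward difference of a sequence. -/
def iterDiff {E : Type*} [AddCommGroup E] (f : ℕ → E) : ℕ → ℕ → E
  | 0, n => f n
  | (j + 1), n => iterDiff f j (n + 1) - iterDiff f j n

/-- Membership in the Stolz class `𝒟_r(K, GL(2,ℝ))`: a bounded sequence of (continuous,
invertible-matrix-valued) functions on `K`, in the supremum norm, whose iterated
differences satisfy `∑_n (sup_K ‖Δ^m F_n‖)^{r/m} < ∞` for `1 ≤ m ≤ r`. -/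
def memDK (r : ℕ) (K : Set ℝ) (F : ℕ → ℝ → Mat2) : Prop :=
  (∃ C, ∀ n, ∀ x ∈ K, ‖F n x‖ ≤ C) ∧
    (∀ n, ∀ x ∈ K, IsUnit (F n x)) ∧
    ∀ m ∈ Finset.Icc 1 r,
      Summable fun n : ℕ => (⨆ x : K, ‖iterDiff F m n (x : ℝ)‖) ^ ((r : ℝ) / m)

/-- Solutions of the three-term recurrence as polynomials; `solP a b n c d k` is `u_{n-1+k}`. -/
def solP (a b : ℕ → ℝ) (n : ℕ) (c d : ℝ) : ℕ → Polynomial ℝ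
  | 0 => Polynomial.C c
  | 1 => Polynomial.C d
  | (k + 2) => Polynomial.C (1 / a (n + k)) * ((Polynomial.X - Polynomial.C (b (n + k))) *
      solP a b n c d (k + 1) - Polynomial.C (a (n + k - 1)) * solP a b n c d k)

lemma solP_degree (a b : ℕ → ℝ) (n : ℕ) (c d : ℝ) (k : ℕ) :
    (solP a b n c d k).degree ≤ (k : ℕ) ∧ (solP a b n c d (k + 1)).degree ≤ ((k + 1 : ℕ) : ℕ) := by
  simp only [← Polynomial.natDegree_le_iff_degree_le]
  induction k with
  | zero => simp [solP]
  | succ k ih =>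
    refine ⟨ih.2, ?_⟩
    rw [solP]
    refine (Polynomial.natDegree_C_mul_le _ _).trans ?_
    refine (Polynomial.natDegree_sub_le _ _).trans (max_le ?_ ?_)
    · refine Polynomial.natDegree_mul_le.trans ?_
      have := Polynomial.natDegree_X_sub_C (b (n + k))
      have := ih.2
      omega
    · refine (Polynomial.natDegree_C_mul_le _ _).trans ?_
      have := ih.1
      omega

lemma solP_wronsk (a b : ℕ → ℝ) (ha : ∀ n, 0 < a n) (n : ℕ) (c d c₂ d₂ : ℝ) (x : ℝ) (k : ℕ) :
    a (n + k - 1) * ((solP a b n c d k).eval x * (solP a b n c₂ d₂ (k + 1)).eval x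
      - (solP a b n c d (k + 1)).eval x * (solP a b n c₂ d₂ k).eval x)
      = a (n - 1) * (c * d₂ - d * c₂) := by
  induction k with
  | zero => simp [solP]
  | succ k ih =>
    rw [← ih]
    have h := (ha (n + k)).ne'
    simp only [solP, Polynomial.eval_mul, Polynomial.eval_sub, Polynomial.eval_C,
      Polynomial.eval_X, show n + (k + 1) - 1 = n + k by omega]
    field_simp
    ring

lemma solP_deriv (a b : ℕ → ℝ) (ha : ∀ n, 0 < a n) (n : ℕ) (c d : ℝ) (x : ℝ) (k : ℕ) :
    a (n + k - 1) * ((solP a b n c d k).eval x * (solP a b n c d (k + 1)).derivative.eval x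
      - (solP a b n c d (k + 1)).eval x * (solP a b n c d k).derivative.eval x)
      = ∑ m ∈ Finset.range k, ((solP a b n c d (m + 1)).eval x) ^ 2 := by
  induction k with
  | zero => simp [solP]
  | succ k ih =>
    rw [Finset.sum_range_succ, ← ih]
    have h := (ha (n + k)).ne'
    simp only [solP, Polynomial.eval_mul, Polynomial.eval_sub, Polynomial.eval_C,
      Polynomial.eval_X, show n + (k + 1) - 1 = n + k by omega, Polynomial.derivative_mul,
      Polynomial.derivative_sub, Polynomial.derivative_C, Polynomial.derivative_X,
      Polynomial.eval_add, Polynomial.eval_zero, Polynomial.eval_one]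
    field_simp
    ring

lemma prodD_eq (a b : ℕ → ℝ) (n : ℕ) (x : ℝ) (k : ℕ) :
    prodD (fun j => Bmat a b j x) n k =
      !![(solP a b n 1 0 k).eval x, (solP a b n 0 1 k).eval x;
        (solP a b n 1 0 (k + 1)).eval x, (solP a b n 0 1 (k + 1)).eval x] := by
  induction k with
  | zero => simp [prodD, solP, Matrix.one_fin_two]
  | succ k ih =>
    rw [prodD, ih, Bmat, Matrix.mul_fin_two]
    simp only [solP, Polynomial.eval_mul, Polynomial.eval_sub, Polynomial.eval_C,
      Polynomial.eval_X]
    ext p q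
    fin_cases p <;> fin_cases q <;> simp <;> ring

lemma deriv_bound (N : ℕ) (u v : ℝ) (huv : u < v) : ∃ D : ℝ, 0 ≤ D ∧ ∀ P : Polynomial ℝ,
    P.degree ≤ (N : ℕ) → ∀ C : ℝ, (∀ x ∈ Set.Icc u v, |P.eval x| ≤ C) →
      |P.derivative.eval u| ≤ D * C := by
  classical
  let w : ℕ → ℝ := fun k => u + (v - u) * (k / (N + 1))
  have hN : (0 : ℝ) < N + 1 := by positivity
  have hw : Set.InjOn w (Finset.range (N + 1) : Finset ℕ) := by
    intro p _ q _ h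
    have h2 : (v - u) ≠ 0 := by linarith
    simp only [w, add_right_inj] at h
    have h3 := mul_left_cancel₀ h2 h
    have h4 := (div_left_inj' hN.ne').1 h3
    exact_mod_cast h4
  have hmem : ∀ k ∈ Finset.range (N + 1), w k ∈ Set.Icc u v := by
    intro k hk
    have hk' : (k : ℝ) ≤ N + 1 := by exact_mod_cast (Finset.mem_range.1 hk).le
    have h1 : (k : ℝ) / (N + 1) ≤ 1 := (div_le_one hN).2 hk'
    have h0 : 0 ≤ (k : ℝ) / (N + 1) := by positivity
    constructor <;> simp only [w] <;> nlinarith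
  refine ⟨∑ k ∈ Finset.range (N + 1),
    |(Lagrange.basis (Finset.range (N + 1)) w k).derivative.eval u|,
    Finset.sum_nonneg (fun _ _ => abs_nonneg _), ?_⟩
  intro P hP C hC
  have hdeg : P.degree < (Finset.range (N + 1)).card := by
    rw [Finset.card_range]
    exact lt_of_le_of_lt hP (by exact_mod_cast Nat.lt_succ_self N)
  have h := Lagrange.eq_interpolate hw hdeg
  rw [Lagrange.interpolate_apply] at h
  rw [h, Polynomial.derivative_sum, Polynomial.eval_finsetSum, Finset.sum_mul]
  refine (Finset.abs_sum_le_sum_abs _ _).trans (Finset.sum_le_sum fun k hk => ?_)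
  rw [Polynomial.derivative_C_mul, Polynomial.eval_mul, Polynomial.eval_C, abs_mul, mul_comm]
  exact mul_le_mul_of_nonneg_left (hC _ (hmem k hk)) (abs_nonneg _)

/-- Key bound: the squares of the solutions are controlled by the last weight. -/
lemma sol_sq_bound (a b : ℕ → ℝ) (ha : ∀ n, 0 < a n) (n N : ℕ) (c d u v C D : ℝ)
    (huv : u < v) (hD0 : 0 ≤ D)
    (hD : ∀ P : Polynomial ℝ,
      P.degree ≤ ((N + 1 : ℕ) : ℕ) → ∀ C : ℝ, (∀ x ∈ Set.Icc u v, |P.eval x| ≤ C) →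
      |P.derivative.eval u| ≤ D * C)
    (h1 : ∀ x ∈ Set.Icc u v, |(solP a b n c d N).eval x| ≤ C)
    (h2 : ∀ x ∈ Set.Icc u v, |(solP a b n c d (N + 1)).eval x| ≤ C) (m : ℕ) (hm : m < N) :
    ((solP a b n c d (m + 1)).eval u) ^ 2 ≤ a (n + N - 1) * (2 * D * C ^ 2) := by
  have hu : u ∈ Set.Icc u v := ⟨le_rfl, huv.le⟩
  have hC : 0 ≤ C := (abs_nonneg _).trans (h1 u hu)
  have hs := solP_deriv a b ha n c d u N
  have hle := Finset.single_le_sum (f := fun m => ((solP a b n c d (m + 1)).eval u) ^ 2)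
    (s := Finset.range N) (fun _ _ => sq_nonneg _) (Finset.mem_range.2 hm)
  refine hle.trans ?_
  rw [← hs]
  refine mul_le_mul_of_nonneg_left ?_ (ha _).le
  have d1 := hD _ ((solP_degree a b n c d N).1.trans (by exact_mod_cast Nat.le_succ N)) C h1
  have d2 := hD _ (solP_degree a b n c d N).2 C h2
  have e1 := mul_le_mul (h1 u hu) d2 (abs_nonneg _) hC
  have e2 := mul_le_mul (h2 u hu) d1 (abs_nonneg _) hC
  rw [← abs_mul] at e1 e2
  have f1 := le_of_abs_le e1
  have f2 := neg_le_of_abs_le e2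
  nlinarith

/-- Proposition 8 of the paper. Under the hypotheses of Theorem C of
Świderski–Trojan (compact interval inside `Λ`, ratio → 1, Stolz class `𝒟_r`), the Jacobi
parameters `a_n` are bounded away from `0`. -/
theorem inf_pos_of_Dr
    (N : ℕ) (hN : 0 < N) (r : ℕ) (hr : 0 < r)
    (a b : ℕ → ℝ) (ha : ∀ n, 0 < a n)
    (i : ℕ) (hi : i < N) (u v : ℝ) (huv : u < v)
    (hΛ : ∀ x ∈ Set.Icc u v, ∃ d < (0 : ℝ),
      Tendsto (fun j : ℕ => discr (Xmat a b N (j * N + i) x)) atTop (𝓝 d))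
    (hratio : Tendsto (fun j : ℕ => a ((j + 1) * N + i - 1) / a (j * N + i - 1))
      atTop (𝓝 1))
    (hDr : memDK r (Set.Icc u v) (fun j x => Xmat a b N (j * N + i) x)) :
    ∃ ε > 0, ∀ n : ℕ, ε ≤ a n := by
  obtain ⟨⟨C, hC⟩, -, -⟩ := hDr
  obtain ⟨D, hD0, hD⟩ := deriv_bound (N + 1) u v huv
  obtain ⟨R, hR⟩ := hratio.bddAbove_range
  have hR' : ∀ j : ℕ, a ((j + 1) * N + i - 1) ≤ R * a (j * N + i - 1) := fun j => by
    have := hR ⟨j, rfl⟩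
    exact (div_le_iff₀ (ha _)).1 this
  have hRpos : 0 < R := by
    have h := hR' 0
    by_contra hneg
    have := ha ((0 + 1) * N + i - 1)
    have := ha (0 * N + i - 1)
    nlinarith
  have hu : u ∈ Set.Icc u v := ⟨le_rfl, huv.le⟩
  set M := 2 * D * C ^ 2 with hM
  have hent : ∀ j : ℕ, ∀ x ∈ Set.Icc u v, ∀ p q, |Xmat a b N (j * N + i) x p q| ≤ C := by
    intro j x hx p q
    exact (Matrix.norm_entry_le_entrywise_sup_norm _).trans (hC j x hx)
  have hu1 : ∀ j : ℕ, ∀ m < N, ((solP a b (j * N + i) 0 1 (m + 1)).eval u) ^ 2 ≤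
      a (j * N + i + N - 1) * M := fun j m hm =>
    sol_sq_bound a b ha _ N 0 1 u v C D huv hD0 hD
      (fun x hx => by simpa [Xmat, prodD_eq] using hent j x hx 0 1)
      (fun x hx => by simpa [Xmat, prodD_eq] using hent j x hx 1 1) m hm
  have hw1 : ∀ j : ℕ, ∀ m < N, ((solP a b (j * N + i) 1 0 (m + 1)).eval u) ^ 2 ≤
      a (j * N + i + N - 1) * M := fun j m hm =>
    sol_sq_bound a b ha _ N 1 0 u v C D huv hD0 hD
      (fun x hx => by simpa [Xmat, prodD_eq] using hent j x hx 0 0)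
      (fun x hx => by simpa [Xmat, prodD_eq] using hent j x hx 1 0) m hm
  have hg : ∀ j : ℕ, 1 ≤ a (j * N + i + N - 1) * M := fun j => by
    simpa [solP] using hu1 j 0 hN
  have hMpos : 0 < M := by
    have := hg 0
    have := ha (0 * N + i + N - 1)
    by_contra hneg
    nlinarith
  have hmid : ∀ j : ℕ, ∀ m, m + 1 < N → 1 ≤ a (j * N + i + m) * (2 * M * R) := by
    intro j m hm
    have hW := solP_wronsk a b ha (j * N + i) 1 0 0 1 u (m + 1)
    rw [show j * N + i + (m + 1) - 1 = j * N + i + m by omega] at hW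
    have p1 := hu1 j m (by omega)
    have p2 := hu1 j (m + 1) hm
    have p3 := hw1 j m (by omega)
    have p4 := hw1 j (m + 1) hm
    have hr := hR' j
    rw [show (j + 1) * N + i - 1 = j * N + i + N - 1 by rw [add_mul, one_mul]; congr 1; omega] at hr
    have hα := ha (j * N + i - 1)
    have ham := ha (j * N + i + m)
    set w0 := (solP a b (j * N + i) 1 0 (m + 1)).eval u
    set w1 := (solP a b (j * N + i) 1 0 (m + 1 + 1)).eval u
    set u0 := (solP a b (j * N + i) 0 1 (m + 1)).eval u
    set u1 := (solP a b (j * N + i) 0 1 (m + 1 + 1)).eval u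
    have hX : w0 * u1 - w1 * u0 ≤ 2 * M * (R * a (j * N + i - 1)) := by
      have : w0 * u1 - w1 * u0 ≤ 2 * M * a (j * N + i + N - 1) := by
        nlinarith [sq_nonneg (w0 - u1), sq_nonneg (w1 + u0)]
      exact this.trans (mul_le_mul_of_nonneg_left hr (by positivity))
    have hY := mul_le_mul_of_nonneg_left hX ham.le
    rw [hW] at hY
    have : a (j * N + i - 1) * 1 ≤ a (j * N + i - 1) * (a (j * N + i + m) * (2 * M * R)) := by
      linarith
    exact le_of_mul_le_mul_left this hα
  obtain ⟨ε₀, hε₀, hfin⟩ : ∃ ε > 0, ∀ n < i, ε ≤ a n := by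
    clear * - ha
    induction i with
    | zero => exact ⟨1, one_pos, by simp⟩
    | succ k ih =>
      obtain ⟨e, he, h⟩ := ih
      refine ⟨min e (a k), lt_min he (ha k), fun n hn => ?_⟩
      rcases Nat.lt_succ_iff_lt_or_eq.1 hn with h' | rfl
      · exact (min_le_left _ _).trans (h n h')
      · exact min_le_right _ _
  have hMR : 0 < 2 * M * R := by positivity
  refine ⟨min ε₀ (min (1 / M) (1 / (2 * M * R))), by positivity, fun n => ?_⟩
  rcases lt_or_ge n i with hn | hn
  · exact (min_le_left _ _).trans (hfin n hn)
  · refine (min_le_right _ _).trans ?_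
    have hdm := Nat.div_add_mod (n - i) N
    have hlt := Nat.mod_lt (n - i) hN
    set j := (n - i) / N
    set m := (n - i) % N
    have hnn : n = j * N + i + m := by rw [mul_comm] at hdm; omega
    rcases lt_or_ge (m + 1) N with h | h
    · refine (min_le_right _ _).trans ?_
      rw [div_le_iff₀ hMR, hnn]
      exact hmid j m h
    · refine (min_le_left _ _).trans ?_
      rw [div_le_iff₀ hMpos, hnn, show j * N + i + m = j * N + i + N - 1 by omega]
      exact hg j
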